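/- For every z with 0 < z < 1, ψ(z) > 0. -/

import Mathlib

/-- `a n = (4/n^4)·tanh(nπ/2) − π/n^3`. -/
noncomputable def a (n : ℕ) : ℝ :=
  4 / (n : ℝ) ^ 4 * Real.tanh ((n : ℝ) * Real.pi / 2) - Real.pi / (n : ℝ) ^ 3

/-- `ψ(z) = (24/π^4) · Σ_{n odd} a_n · sin(nπz)`, the sum over odd positive integers. -/
noncomputable def psi (z : ℝ) : ℝ :=
  (24 / Real.pi ^ 4) * ∑' k : ℕ, a (2 * k + 1) * Real.sin ((2 * (k : ℝ) + 1) * Real.pi * z)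

lemma aux_congr {f g : ℕ → ℝ} {s t : ℝ} (h : HasSum f s) (h1 : ∀ k, g k = f k) (h2 : t = s) :
    HasSum g t := by
  have : g = f := funext h1
  rwa [this, h2]

lemma aux_mul {f g : ℕ → ℝ} {s t : ℝ} (h : HasSum f s) (h' : HasSum g t) (hf : ∀ k, 0 ≤ f k)
    (hg : ∀ k, 0 ≤ g k) : HasSum (fun p : ℕ × ℕ => f p.1 * g p.2) (s * t) :=
  h.mul h' (h.summable.mul_of_nonneg h'.summable hf hg)

lemma aux_congrC {f g : ℕ → ℂ} {s t : ℂ} (h : HasSum f s) (h1 : ∀ k, g k = f k) (h2 : t = s) :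
    HasSum g t := by
  have : g = f := funext h1
  rwa [this, h2]

open Real in
lemma aux_coth (x : ℝ) (hx : 0 < x) :
    HasSum (fun k : ℕ => 2 * x / (x ^ 2 + ((k : ℝ) + 1) ^ 2))
      (π * (cosh (π * x) / sinh (π * x)) - 1 / x) := by
  have hz : (x * Complex.I : ℂ) ∈ Complex.integerComplement := by
    rintro ⟨n, hn⟩
    have := congrArg Complex.im hn
    simp at this
    linarith
  have h1 := cot_series_rep' hz
  have h2 : Summable fun n : ℕ => (1 / ((x * Complex.I : ℂ) - (n + 1)) + 1 / ((x * Complex.I : ℂ) + (n + 1))) :=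
    summable_cotTerm hz
  have h3 := h2.hasSum
  rw [← h1] at h3
  have h4 := h3.mul_left Complex.I
  have hx0 : (x : ℂ) ≠ 0 := by exact_mod_cast hx.ne'
  have hs : (Complex.sinh (π * x) : ℂ) ≠ 0 := by
    have : Real.sinh (π * x) ≠ 0 := (Real.sinh_pos_iff.2 (by positivity)).ne'
    exact_mod_cast this
  rw [← Complex.hasSum_ofReal]
  refine aux_congrC h4 ?_ ?_
  · intro k
    have e1 : (x * Complex.I : ℂ) - (k + 1) ≠ 0 := by
      intro h
      have := congrArg Complex.im h
      simp at this
      linarith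
    have e2 : (x * Complex.I : ℂ) + (k + 1) ≠ 0 := by
      intro h
      have := congrArg Complex.im h
      simp at this
      linarith
    have e3 : (x : ℂ) ^ 2 + ((k : ℂ) + 1) ^ 2 ≠ 0 := by
      have : x ^ 2 + ((k : ℝ) + 1) ^ 2 ≠ 0 := by positivity
      exact_mod_cast this
    push_cast
    rw [one_div_add_one_div e1 e2]
    have e4 : ((x * Complex.I : ℂ) - (k + 1)) * ((x * Complex.I : ℂ) + (k + 1)) = - ((x : ℂ) ^ 2 + ((k : ℂ) + 1) ^ 2) := by
      linear_combination (x : ℂ) ^ 2 * Complex.I_sq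
    rw [e4]
    field_simp
    linear_combination (2 * (x : ℂ)) * Complex.I_sq
  · have hc : (π : ℂ) * (x * Complex.I) = ((π * x : ℂ)) * Complex.I := by ring
    rw [Complex.cot, hc, Complex.cos_mul_I, Complex.sin_mul_I]
    push_cast
    field_simp

open Real in
lemma aux_tanh (x : ℝ) (hx : 0 < x) :
    HasSum (fun k : ℕ => 4 * x / (x ^ 2 + (2 * (k : ℝ) + 1) ^ 2)) (π * tanh (x * π / 2)) := by
  have h1 := (aux_coth x hx).mul_left 2
  have h2 := aux_coth (x / 2) (by positivity)
  set f : ℕ → ℝ := fun k => 2 * (2 * x / (x ^ 2 + ((k : ℝ) + 1) ^ 2)) with hf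
  have hodd : (fun k : ℕ => 2 * (x / 2) / ((x / 2) ^ 2 + ((k : ℝ) + 1) ^ 2)) = fun k => f (2 * k + 1) := by
    funext k
    simp only [hf]
    push_cast
    have e1 : (x / 2) ^ 2 + ((k : ℝ) + 1) ^ 2 ≠ 0 := by positivity
    have e2 : x ^ 2 + (2 * (k : ℝ) + 1 + 1) ^ 2 ≠ 0 := by positivity
    field_simp
    ring
  have heven : (fun k : ℕ => 4 * x / (x ^ 2 + (2 * (k : ℝ) + 1) ^ 2)) = fun k => f (2 * k) := by
    funext k
    simp only [hf]
    push_cast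
    ring
  rw [hodd] at h2
  rw [heven]
  have hs : Summable fun k => f (2 * k) :=
    h1.summable.comp_injective (fun a b h => by simpa using h)
  have h3 := hs.hasSum.even_add_odd h2
  have h4 := h3.unique h1
  have h5 : (∑' k, f (2 * k)) = π * tanh (x * π / 2) := by
    rw [eq_sub_of_add_eq h4, tanh_eq_sinh_div_cosh]
    have e1 : π * x = 2 * (x * π / 2) := by ring
    have e2 : π * (x / 2) = x * π / 2 := by ring
    rw [e1, e2, sinh_two_mul, cosh_two_mul]
    have s : sinh (x * π / 2) ≠ 0 := (sinh_pos_iff.2 (by positivity)).ne'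
    have c : cosh (x * π / 2) ≠ 0 := (cosh_pos _).ne'
    generalize sinh (x * π / 2) = S at *
    generalize cosh (x * π / 2) = C at *
    field_simp
    ring
  rw [← h5]
  exact hs.hasSum

open Real in
lemma aux_sq : HasSum (fun k : ℕ => 1 / (2 * (k : ℝ) + 1) ^ 2) (π ^ 2 / 8) := by
  have h1 := hasSum_zeta_two
  set f : ℕ → ℝ := fun n => 1 / (n : ℝ) ^ 2 with hf
  have heven : HasSum (fun k => f (2 * k)) (1 / 4 * (π ^ 2 / 6)) := by
    have := h1.mul_left (1 / 4)
    refine aux_congr this ?_ rfl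
    intro k
    simp only [hf]
    push_cast
    rw [mul_pow, div_mul_div_comm]
    norm_num
  have hs : Summable fun k => f (2 * k + 1) :=
    h1.summable.comp_injective (fun a b h => by simpa using h)
  have h4 := (heven.even_add_odd hs.hasSum).unique h1
  have h5 : (∑' k, f (2 * k + 1)) = π ^ 2 / 8 := by linarith
  rw [← h5]
  refine aux_congr hs.hasSum ?_ rfl
  intro k
  simp [hf]

open Real in
lemma aux_cube : HasSum (fun k : ℕ => tanh ((2 * (k : ℝ) + 1) * π / 2) / (2 * (k : ℝ) + 1) ^ 3)
    (π ^ 3 / 32) := by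
  let g : ℕ × ℕ → ℝ := fun p =>
    1 / ((2 * (p.1 : ℝ) + 1) ^ 2 * ((2 * (p.1 : ℝ) + 1) ^ 2 + (2 * (p.2 : ℝ) + 1) ^ 2))
  have hsq : HasSum (fun p : ℕ × ℕ => 1 / (2 * (p.1 : ℝ) + 1) ^ 2 * (1 / (2 * (p.2 : ℝ) + 1) ^ 2))
      (π ^ 2 / 8 * (π ^ 2 / 8)) := by
    have h := aux_mul aux_sq aux_sq (fun k => by positivity) (fun k => by positivity)
    exact h
  have hg : Summable g := by
    refine Summable.of_nonneg_of_le (fun p => by positivity) (fun p => ?_) hsq.summable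
    simp only [g]
    rw [div_mul_div_comm, one_mul]
    gcongr
    have : 0 ≤ (2 * (p.1 : ℝ) + 1) ^ 2 := by positivity
    linarith
  have hg' : HasSum (fun p : ℕ × ℕ => g p.swap) (∑' p, g p) :=
    (Equiv.prodComm ℕ ℕ).hasSum_iff.2 hg.hasSum
  have hadd := hg.hasSum.add hg'
  have heq : (fun p : ℕ × ℕ => g p + g p.swap) =
      fun p : ℕ × ℕ => 1 / (2 * (p.1 : ℝ) + 1) ^ 2 * (1 / (2 * (p.2 : ℝ) + 1) ^ 2) := by
    funext p
    simp only [g, Prod.fst_swap, Prod.snd_swap]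
    have e1 : 2 * (p.1 : ℝ) + 1 ≠ 0 := by positivity
    have e2 : 2 * (p.2 : ℝ) + 1 ≠ 0 := by positivity
    have e3 : (2 * (p.1 : ℝ) + 1) ^ 2 + (2 * (p.2 : ℝ) + 1) ^ 2 ≠ 0 := by positivity
    rw [add_comm ((2 * (p.2 : ℝ) + 1) ^ 2)]
    generalize 2 * (p.1 : ℝ) + 1 = u at *
    generalize 2 * (p.2 : ℝ) + 1 = v at *
    field_simp
    ring
  rw [heq] at hadd
  have htot := hadd.unique hsq
  have hfib := hg.hasSum.prod_fiberwise (g := fun k : ℕ =>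
    π / 4 * (tanh ((2 * (k : ℝ) + 1) * π / 2) / (2 * (k : ℝ) + 1) ^ 3)) (fun k => by
      have := (aux_tanh (2 * (k : ℝ) + 1) (by positivity)).mul_left (1 / (4 * (2 * (k : ℝ) + 1) ^ 3))
      refine aux_congr this ?_ ?_
      · intro j
        simp only [g]
        have e1 : 2 * (k : ℝ) + 1 ≠ 0 := by positivity
        have e3 : (2 * (k : ℝ) + 1) ^ 2 + (2 * (j : ℝ) + 1) ^ 2 ≠ 0 := by positivity
        field_simp
      · have e1 : 2 * (k : ℝ) + 1 ≠ 0 := by positivity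
        field_simp)
  have := hfib.mul_left (4 / π)
  have hp := pi_ne_zero
  refine aux_congr this ?_ ?_
  · intro k
    field_simp
  · rw [show (∑' p, g p) = π ^ 4 / 128 by linarith]
    field_simp
    norm_num

lemma aux_sin (n : ℕ) (x : ℝ) : |Real.sin (n * x)| ≤ n * |Real.sin x| := by
  induction n with
  | zero => simp
  | succ n ih =>
    push_cast
    rw [add_mul, one_mul, Real.sin_add]
    refine (abs_add_le _ _).trans ?_
    rw [abs_mul, abs_mul]
    have h1 := Real.abs_cos_le_one x
    have h2 := Real.abs_cos_le_one (n * x)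
    have h3 := mul_le_mul_of_nonneg_left h1 (abs_nonneg (Real.sin (n * x)))
    have h4 := mul_le_mul_of_nonneg_right h2 (abs_nonneg (Real.sin x))
    linarith

open Real in
lemma aux_lin : HasSum (fun k : ℕ => (2 * (k : ℝ) + 1) * a (2 * k + 1)) 0 := by
  have h := (aux_cube.mul_left 4).sub (aux_sq.mul_left π)
  refine aux_congr h ?_ ?_
  · intro k
    simp only [a]
    push_cast
    have e1 : 2 * (k : ℝ) + 1 ≠ 0 := by positivity
    field_simp
  · ring

open Real in
lemma aux_neg (k : ℕ) : a (2 * (k + 1) + 1) < 0 := by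
  simp only [a]
  push_cast
  have e1 : 3 ≤ 2 * ((k : ℝ) + 1) + 1 := by
    have : (0 : ℝ) ≤ k := by positivity
    linarith
  generalize 2 * ((k : ℝ) + 1) + 1 = n at *
  have hn : 0 < n := by linarith
  have ht := tanh_lt_one (n * π / 2)
  have hp := pi_gt_three
  have : 4 / n ^ 4 * tanh (n * π / 2) - π / n ^ 3 = (4 * tanh (n * π / 2) - n * π) / n ^ 4 := by
    field_simp
  rw [this]
  apply div_neg_of_neg_of_pos _ (by positivity)
  nlinarith

open Real in
/-- `ψ(z) > 0` for all `0 < z < 1`. -/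
theorem psi_pos : ∀ z : ℝ, 0 < z → z < 1 → 0 < psi z := by
  intro z h0 h1
  have hs : 0 < sin (π * z) :=
    sin_pos_of_pos_of_lt_pi (by positivity) (by nlinarith [pi_pos])
  unfold psi
  refine mul_pos (by positivity) ?_
  have hL := aux_lin.mul_right (sin (π * z))
  rw [zero_mul] at hL
  have hsin : ∀ k : ℕ, |sin ((2 * (k : ℝ) + 1) * π * z)| ≤ (2 * (k : ℝ) + 1) * sin (π * z) := by
    intro k
    have := aux_sin (2 * k + 1) (π * z)
    rw [abs_of_pos hs] at this
    push_cast at this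
    rwa [← mul_assoc] at this
  have hsum : Summable fun k : ℕ => a (2 * k + 1) * sin ((2 * (k : ℝ) + 1) * π * z) := by
    refine Summable.of_norm_bounded hL.summable.norm (fun k => ?_)
    rw [norm_mul, norm_mul, norm_mul, norm_eq_abs (sin _), norm_eq_abs (sin (π * z)), abs_of_pos hs,
      norm_eq_abs (2 * (k : ℝ) + 1), abs_of_pos (by positivity : 0 < 2 * (k : ℝ) + 1)]
    have := mul_le_mul_of_nonneg_left (hsin k) (norm_nonneg (a (2 * k + 1)))
    linarith
  rw [← hL.tsum_eq]
  refine Summable.tsum_lt_tsum (i := 1) (fun k => ?_) ?_ hL.summable hsum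
  · rcases k with _ | k
    · simp
    · have := mul_le_mul_of_nonpos_left ((le_abs_self _).trans (hsin (k + 1))) (aux_neg k).le
      linarith
  · have h3 : sin ((2 * ((1 : ℕ) : ℝ) + 1) * π * z) < (2 * ((1 : ℕ) : ℝ) + 1) * sin (π * z) := by
      have : (2 * ((1 : ℕ) : ℝ) + 1) * π * z = 3 * (π * z) := by push_cast; ring
      rw [this, sin_three_mul]
      have := pow_pos hs 3
      push_cast
      linarith
    have := mul_lt_mul_of_neg_left h3 (aux_neg 0)
    simp only [zero_add] at this
    linarith
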